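/- arXiv:1004.5304 — 2 statements merged into one kernel-verified Lean document; each statement's English description precedes it below -/
import Mathlib

section
/- Let n ≥ 2, s ∈ (0,1] and p ∈ (n/(n+s), n/s). Every bounded Ṁ^{s,p}_ball-extension domain Ω ⊆ ℝⁿ supports a (pn/(n−ps), p)_s-Hajłasz–Sobolev–Poincaré imbedding. -/
open MeasureTheory Metric Set
open scoped ENNReal

noncomputable section

/-- Euclidean space `ℝⁿ`. -/
abbrev Eu (n : ℕ) : Type := EuclideanSpace ℝ (Fin n)

/-- A domain: a nonempty open connected subset. -/
def IsDomainEu {n : ℕ} (Ω : Set (Eu n)) : Prop := IsOpen Ω ∧ IsConnected Ω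

/-- The Hajłasz gradient class `𝒟^{s,ρ}_ball(u)` on `Ω`: nonnegative measurable `g` such that
`|u x - u y| ≤ |x-y|^s (g x + g y)` for all `x, y ∈ Ω` off a null set with
`|x - y| < ρ · dist(x, ∂Ω)`. -/
def DBall {n : ℕ} (Ω : Set (Eu n)) (s ρ : ℝ) (u : Eu n → ℝ) : Set (Eu n → ℝ) :=
  {g | Measurable g ∧ (∀ x, 0 ≤ g x) ∧
    ∃ N : Set (Eu n), N ⊆ Ω ∧ volume N = 0 ∧
      ∀ x ∈ Ω \ N, ∀ y ∈ Ω \ N,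
        edist x y < ENNReal.ofReal ρ * EMetric.infEdist x Ωᶜ →
        |u x - u y| ≤ dist x y ^ s * (g x + g y)}

/-- The full Hajłasz gradient class `𝒟^s(u)` on `U`. -/
def DFull {n : ℕ} (U : Set (Eu n)) (s : ℝ) (u : Eu n → ℝ) : Set (Eu n → ℝ) :=
  {g | Measurable g ∧ (∀ x, 0 ≤ g x) ∧
    ∃ N : Set (Eu n), N ⊆ U ∧ volume N = 0 ∧
      ∀ x ∈ U \ N, ∀ y ∈ U \ N, |u x - u y| ≤ dist x y ^ s * (g x + g y)}

/-- `inf_{g ∈ 𝒟^{s,ρ}_ball(u)} ‖g‖_{L^p(Ω)}`. -/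
def ballNormRho {n : ℕ} (Ω : Set (Eu n)) (s p ρ : ℝ) (u : Eu n → ℝ) : ℝ≥0∞ :=
  ⨅ g ∈ DBall Ω s ρ u, eLpNorm g (ENNReal.ofReal p) (volume.restrict Ω)

/-- The `Ṁ^{s,p}_ball(Ω)` seminorm (with `ρ = 1/2`). -/
def ballNorm {n : ℕ} (Ω : Set (Eu n)) (s p : ℝ) (u : Eu n → ℝ) : ℝ≥0∞ :=
  ballNormRho Ω s p (1/2) u

/-- The `Ṁ^{s,p}(U)` seminorm. -/
def fullNorm {n : ℕ} (U : Set (Eu n)) (s p : ℝ) (u : Eu n → ℝ) : ℝ≥0∞ :=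
  ⨅ g ∈ DFull U s u, eLpNorm g (ENNReal.ofReal p) (volume.restrict U)

/-- Membership in `Ṁ^{s,p}_ball(Ω)`. -/
def MemMball {n : ℕ} (Ω : Set (Eu n)) (s p : ℝ) (u : Eu n → ℝ) : Prop :=
  Measurable u ∧ ballNorm Ω s p u < ⊤

/-- Membership in `Ṁ^{s,p}(U)`. -/
def MemMfull {n : ℕ} (U : Set (Eu n)) (s p : ℝ) (u : Eu n → ℝ) : Prop :=
  Measurable u ∧ fullNorm U s p u < ⊤

/-- `Ω` supports a `(pn/(n-ps), p)_s`-Hajłasz–Sobolev–Poincaré imbedding. -/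
def SupportsHSP {n : ℕ} (Ω : Set (Eu n)) (s p : ℝ) : Prop :=
  ∃ C : ℝ, 0 < C ∧ ∀ u : Eu n → ℝ, MemMball Ω s p u →
    eLpNorm (fun x => u x - ⨍ y in Ω, u y)
        (ENNReal.ofReal (p * n / (n - p * s))) (volume.restrict Ω)
      ≤ ENNReal.ofReal C * ballNorm Ω s p u

/-- LLC(2) with constant `b`: points of `Ω \ B(z,r)` lie in the same connected component
of `Ω \ B(z, br)`. -/
def LLC2With {n : ℕ} (Ω : Set (Eu n)) (b : ℝ) : Prop :=
  ∀ (z : Eu n) (r : ℝ), 0 < r →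
    ∀ x ∈ Ω \ ball z r, ∀ y ∈ Ω \ ball z r,
      y ∈ connectedComponentIn (Ω \ ball z (b * r)) x

/-- The LLC(2) property. -/
def LLC2 {n : ℕ} (Ω : Set (Eu n)) : Prop :=
  ∃ b : ℝ, b ∈ Set.Ioo (0:ℝ) 1 ∧ LLC2With Ω b

/-- `Ω` is an `Ṁ^{s,p}_ball`-extension domain. -/
def IsMballExtensionDomain {n : ℕ} (Ω : Set (Eu n)) (s p : ℝ) : Prop :=
  ∃ C : ℝ, 0 < C ∧ ∀ u : Eu n → ℝ, MemMball Ω s p u →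
    ∃ v : Eu n → ℝ, MemMball (Set.univ) s p v ∧ (∀ x ∈ Ω, v x = u x) ∧
      ballNorm (Set.univ) s p v ≤ ENNReal.ofReal C * ballNorm Ω s p u

/-- `Ω` is a John domain: there are `x₀ ∈ Ω` and `C > 0` such that every `x ∈ Ω` is joined to
`x₀` by a curve parametrized by arclength (here: `1`-Lipschitz) with
`dist(γ t, Ωᶜ) ≥ C t`. -/
def IsJohnDomain {n : ℕ} (Ω : Set (Eu n)) : Prop :=
  ∃ x₀ ∈ Ω, ∃ C : ℝ, 0 < C ∧ ∀ x ∈ Ω, ∃ ℓ : ℝ, 0 ≤ ℓ ∧ ∃ γ : ℝ → Eu n,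
    LipschitzOnWith 1 γ (Set.Icc 0 ℓ) ∧ γ 0 = x ∧ γ ℓ = x₀ ∧
    ∀ t ∈ Set.Icc (0:ℝ) ℓ, γ t ∈ Ω ∧ C * t ≤ infDist (γ t) Ωᶜ

/-- Quasihyperbolic distance: infimum over arclength-parametrized (`1`-Lipschitz) curves in `Ω`
joining `x` to `y` of `∫ dist(γ t, Ωᶜ)⁻¹ dt`. -/
def qhDist {n : ℕ} (Ω : Set (Eu n)) (x y : Eu n) : ℝ :=
  sInf { k : ℝ | ∃ ℓ : ℝ, 0 ≤ ℓ ∧ ∃ γ : ℝ → Eu n,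
    LipschitzOnWith 1 γ (Set.Icc 0 ℓ) ∧ γ 0 = x ∧ γ ℓ = y ∧
    (∀ t ∈ Set.Icc (0:ℝ) ℓ, γ t ∈ Ω) ∧
    k = ∫ t in (0:ℝ)..ℓ, (infDist (γ t) Ωᶜ)⁻¹ }

/-- Weak carrot domain (quasihyperbolic boundary condition). -/
def IsWeakCarrot {n : ℕ} (Ω : Set (Eu n)) : Prop :=
  ∃ x₀ ∈ Ω, ∃ C : ℝ, 1 ≤ C ∧ ∀ x ∈ Ω,
    qhDist Ω x x₀ ≤ C * Real.log (C / infDist x Ωᶜ)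

/-- The Luxemburg norm `‖u‖_{φ_s(L)(Ω)}` with `φ_s(t) = exp(t^{n/(n-s)}) - 1`
(value `⊤` when no admissible `t` exists). -/
def phiLux {n : ℕ} (Ω : Set (Eu n)) (s : ℝ) (u : Eu n → ℝ) : ℝ≥0∞ :=
  sInf (ENNReal.ofReal '' { t : ℝ | 0 < t ∧
    (∫⁻ x in Ω, ENNReal.ofReal
        (Real.exp ((|u x| / t) ^ ((n : ℝ) / ((n : ℝ) - s))) - 1)) ≤ 1 })

/-- `Ω` supports an `s`-Hajłasz–Trudinger imbedding. -/
def SupportsHT {n : ℕ} (Ω : Set (Eu n)) (s : ℝ) : Prop :=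
  ∃ C : ℝ, 0 < C ∧ ∀ u : Eu n → ℝ, MemMball Ω s ((n : ℝ) / s) u →
    phiLux Ω s (fun x => u x - ⨍ y in Ω, u y)
      ≤ ENNReal.ofReal C * ballNorm Ω s ((n : ℝ) / s) u

/-- The separation property with respect to `x₀` and `C`. -/
def SeparationProperty {n : ℕ} (Ω : Set (Eu n)) (x₀ : Eu n) (C : ℝ) : Prop :=
  ∀ x ∈ Ω, ∃ γ : ℝ → Eu n, ContinuousOn γ (Set.Icc 0 1) ∧
    (∀ t ∈ Set.Icc (0:ℝ) 1, γ t ∈ Ω) ∧ γ 0 = x ∧ γ 1 = x₀ ∧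
    ∀ t ∈ Set.Ioc (0:ℝ) 1,
      γ '' Set.Icc 0 t ⊆ ball (γ t) (C * infDist (γ t) Ωᶜ) ∨
      ∀ y ∈ γ '' Set.Icc 0 t \ ball (γ t) (C * infDist (γ t) Ωᶜ),
        connectedComponentIn (Ω \ sphere (γ t) (C * infDist (γ t) Ωᶜ)) y ≠
          connectedComponentIn (Ω \ sphere (γ t) (C * infDist (γ t) Ωᶜ)) x₀

/-- The slice property with constant `C`. Lengths of curve portions are measured via the
Lebesgue measure of parameter preimages of arclength (`1`-Lipschitz) parametrizations. -/
def SliceProperty {n : ℕ} (Ω : Set (Eu n)) (C : ℝ) : Prop :=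
  ∀ x ∈ Ω, ∀ y ∈ Ω, ∃ (j : ℕ) (S : ℕ → Set (Eu n)) (L : ℝ) (γ : ℝ → Eu n),
    0 ≤ L ∧ LipschitzOnWith 1 γ (Set.Icc 0 L) ∧ γ 0 = x ∧ γ L = y ∧
    (∀ t ∈ Set.Icc (0:ℝ) L, γ t ∈ Ω) ∧
    (∀ i ≤ j, IsOpen (S i) ∧ S i ⊆ Ω) ∧
    (∀ i ≤ j, ∀ k ≤ j, i ≠ k → Disjoint (S i) (S k)) ∧
    x ∈ S 0 ∧ y ∈ S j ∧
    (∀ i, 0 < i → i < j →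
      connectedComponentIn (Ω \ closure (S i)) x ≠
        connectedComponentIn (Ω \ closure (S i)) y) ∧
    (∀ (LF : ℝ) (F : ℝ → Eu n), 0 ≤ LF → LipschitzOnWith 1 F (Set.Icc 0 LF) →
      F '' Set.Icc 0 LF ⊆ Ω → (∃ t ∈ Set.Icc (0:ℝ) LF, F t = x) →
      (∃ t ∈ Set.Icc (0:ℝ) LF, F t = y) →
      ∀ i, 0 < i → i < j →
        Metric.diam (S i) ≤ C * (volume {t : ℝ | t ∈ Set.Icc (0:ℝ) LF ∧ F t ∈ S i}).toReal) ∧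
    (∀ t ∈ Set.Icc (0:ℝ) L,
      ball (γ t) (C⁻¹ * infDist (γ t) Ωᶜ) ⊆ ⋃ i ∈ Finset.range (j + 1), S i) ∧
    (∀ i ≤ j, ∀ z ∈ γ '' Set.Icc (0:ℝ) L ∩ S i, Metric.diam (S i) ≤ C * infDist z Ωᶜ) ∧
    (∃ xi : ℕ → Eu n, xi 0 = x ∧ xi j = y ∧
      ∀ i ≤ j, xi i ∈ S i ∧ ball (xi i) (C⁻¹ * infDist (xi i) Ωᶜ) ⊆ S i)

/-- `v : Ω → ℝⁿ` is a distributional gradient of `u` on `U`. -/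
def HasDistribGradOn {n : ℕ} (U : Set (Eu n)) (u : Eu n → ℝ) (v : Eu n → Eu n) : Prop :=
  ∀ φ : Eu n → ℝ, ContDiff ℝ (⊤ : ℕ∞) φ → HasCompactSupport φ → tsupport φ ⊆ U →
    ∀ i : Fin n,
      ∫ x in U, u x * fderiv ℝ φ x (EuclideanSpace.single i 1) = - ∫ x in U, v x i * φ x

/-- `u ∈ Ẇ^{1,p}(U)` with distributional gradient `v ∈ L^p(U;ℝⁿ)`. -/
def MemW1p {n : ℕ} (U : Set (Eu n)) (p : ℝ) (u : Eu n → ℝ) (v : Eu n → Eu n) : Prop :=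
  LocallyIntegrableOn u U volume ∧ AEMeasurable v (volume.restrict U) ∧
    eLpNorm v (ENNReal.ofReal p) (volume.restrict U) < ⊤ ∧ HasDistribGradOn U u v

/-- `Ω` is a `Ẇ^{1,p}`-extension domain. -/
def IsW1pExtensionDomain {n : ℕ} (Ω : Set (Eu n)) (p : ℝ) : Prop :=
  ∃ C : ℝ, 0 < C ∧ ∀ u v, MemW1p Ω p u v →
    ∃ u' v', MemW1p (Set.univ) p u' v' ∧ (∀ᵐ x ∂(volume.restrict Ω), u' x = u x) ∧
      eLpNorm v' (ENNReal.ofReal p) volume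
        ≤ ENNReal.ofReal C * eLpNorm v (ENNReal.ofReal p) (volume.restrict Ω)

/-- The (uncentered over radii, centered) Hardy–Littlewood maximal function, `ℝ≥0∞`-valued. -/
def HLMax {n : ℕ} (g : Eu n → ℝ) (y : Eu n) : ℝ≥0∞ :=
  ⨆ (t : ℝ) (_ : 0 < t), (volume (ball y t))⁻¹ * ∫⁻ z in ball y t, ENNReal.ofReal |g z|

lemma aux_chain_one {X : Type*} [MetricSpace X] (v g : X → ℝ) (N : Set X) (s b t R : ℝ)
    (hs : 0 < s) (hb : 1 < b) (hbs : b ^ s < 2) (ht : 0 < t) (hR : 0 < R)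
    (hg0 : ∀ x, 0 ≤ g x)
    (hv : ∀ x, x ∉ N → ∀ y, y ∉ N → |v x - v y| ≤ dist x y ^ s * (g x + g y))
    (H : ∀ (j : ℕ) (x : X), ∃ y, y ∉ N ∧ g y ≤ t / 2 ^ j ∧ dist x y ≤ R * b ^ j)
    (x : X) (hx : x ∉ N) (hgx : g x ≤ t) (j : ℕ) :
    ∃ y, y ∉ N ∧ g y ≤ t / 2 ^ j ∧ dist x y ≤ R * b / (b - 1) * b ^ j ∧
      |v x - v y| ≤ ((R * b) ^ s * (2 * t)) / (1 - b ^ s / 2) * (1 - (b ^ s / 2) ^ j) := by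
  have hb0 : 0 < b := by linarith
  induction j with
  | zero =>
    refine ⟨x, hx, by simpa using hgx, ?_, by simp⟩
    rw [dist_self]
    have : 0 < b - 1 := by linarith
    positivity
  | succ j ih =>
    obtain ⟨y, hyN, hgy, hdy, hvy⟩ := ih
    obtain ⟨z, hzN, hgz, hdz⟩ := H (j + 1) y
    refine ⟨z, hzN, hgz, ?_, ?_⟩
    · have h1 : R * b / (b - 1) * b ^ (j + 1) = R * b / (b - 1) * b ^ j + R * b ^ (j + 1) := by
        have : b - 1 ≠ 0 := by linarith
        field_simp
        ring
      rw [h1]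
      exact (dist_triangle x y z).trans (add_le_add hdy hdz)
    · have h2 : |v y - v z| ≤ ((R * b) ^ s * (2 * t)) * (b ^ s / 2) ^ j := by
        refine (hv y hyN z hzN).trans ?_
        have h3 : dist y z ^ s ≤ (R * b) ^ s * (b ^ s) ^ j := by
          calc dist y z ^ s ≤ (R * b ^ (j + 1)) ^ s :=
                Real.rpow_le_rpow dist_nonneg hdz hs.le
            _ = (R * b) ^ s * (b ^ s) ^ j := by
                rw [pow_succ', ← mul_assoc, Real.mul_rpow (by positivity) (by positivity),
                  ← Real.rpow_natCast b j, ← Real.rpow_natCast (b ^ s) j,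
                  ← Real.rpow_mul hb0.le, ← Real.rpow_mul hb0.le, mul_comm s]
        have h4 : g y + g z ≤ 2 * t / 2 ^ j := by
          have : t / 2 ^ (j + 1) ≤ t / 2 ^ j := by
            gcongr
            · norm_num
            · omega
          have e : 2 * t / 2 ^ j = t / 2 ^ j + t / 2 ^ j := by ring
          linarith
        calc dist y z ^ s * (g y + g z) ≤ ((R * b) ^ s * (b ^ s) ^ j) * (2 * t / 2 ^ j) :=
              mul_le_mul h3 h4 (add_nonneg (hg0 y) (hg0 z)) (by positivity)
          _ = _ := by rw [div_pow]; ring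
      have h5 : ((R * b) ^ s * (2 * t)) / (1 - b ^ s / 2) * (1 - (b ^ s / 2) ^ (j + 1))
          = ((R * b) ^ s * (2 * t)) / (1 - b ^ s / 2) * (1 - (b ^ s / 2) ^ j)
            + ((R * b) ^ s * (2 * t)) * (b ^ s / 2) ^ j := by
        have : 1 - b ^ s / 2 ≠ 0 := by linarith
        have e : (b ^ s / 2) ^ j - (b ^ s / 2) ^ (j + 1)
            = (b ^ s / 2) ^ j * (1 - b ^ s / 2) := by ring
        have e2 : (1 - (b ^ s / 2) ^ (j + 1))
            = (1 - (b ^ s / 2) ^ j) + (b ^ s / 2) ^ j * (1 - b ^ s / 2) := by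
          rw [← e]; ring
        rw [e2, mul_add]
        congr 1
        generalize b ^ s / 2 = θ at *
        field_simp
      rw [h5]
      exact (abs_sub_le _ (v y) _).trans (add_le_add hvy h2)

lemma aux_chain {X : Type*} [MetricSpace X] (v g : X → ℝ) (N : Set X) (s b t R : ℝ)
    (hs : 0 < s) (hb : 1 < b) (hbs : b ^ s < 2) (ht : 0 < t) (hR : 0 < R)
    (hg0 : ∀ x, 0 ≤ g x)
    (hv : ∀ x, x ∉ N → ∀ y, y ∉ N → |v x - v y| ≤ dist x y ^ s * (g x + g y))
    (H : ∀ (j : ℕ) (x : X), ∃ y, y ∉ N ∧ g y ≤ t / 2 ^ j ∧ dist x y ≤ R * b ^ j)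
    (x : X) (hx : x ∉ N) (hgx : g x ≤ t) (y : X) (hy : y ∉ N) (hgy : g y ≤ t) :
    |v x - v y| ≤ 2 * (((R * b) ^ s * (2 * t)) / (1 - b ^ s / 2)) := by
  have hb0 : 0 < b := by linarith
  have hb1 : 0 < b - 1 := by linarith
  have hbs0 : 0 < b ^ s := Real.rpow_pos_of_pos hb0 s
  have hθ : 0 < 1 - b ^ s / 2 := by linarith
  set B := ((R * b) ^ s * (2 * t)) / (1 - b ^ s / 2) with hB
  have hB0 : 0 ≤ B := by positivity
  set D := R * b / (b - 1) with hD
  have hD0 : 0 ≤ D := by positivity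
  have key : ∀ j : ℕ, |v x - v y| ≤
      2 * B + ((dist x y + 2 * D) ^ s * (2 * t)) * (b ^ s / 2) ^ j := by
    intro j
    obtain ⟨x', hx'N, hgx', hdx', hvx'⟩ :=
      aux_chain_one v g N s b t R hs hb hbs ht hR hg0 hv H x hx hgx j
    obtain ⟨y', hy'N, hgy', hdy', hvy'⟩ :=
      aux_chain_one v g N s b t R hs hb hbs ht hR hg0 hv H y hy hgy j
    rw [← hB] at hvx' hvy'
    rw [← hD] at hdx' hdy'
    have hpw : 0 ≤ (b ^ s / 2) ^ j := by positivity
    have h1 : |v x - v x'| ≤ B := hvx'.trans (by nlinarith)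
    have h2 : |v y - v y'| ≤ B := hvy'.trans (by nlinarith)
    have hbj : 1 ≤ b ^ j := one_le_pow₀ hb.le
    have h3 : |v x' - v y'| ≤ ((dist x y + 2 * D) ^ s * (2 * t)) * (b ^ s / 2) ^ j := by
      refine (hv x' hx'N y' hy'N).trans ?_
      have hd : dist x' y' ≤ (dist x y + 2 * D) * b ^ j := by
        have e1 := dist_triangle4 x' x y y'
        rw [dist_comm x' x] at e1
        have e2 : dist x y ≤ dist x y * b ^ j := le_mul_of_one_le_right dist_nonneg hbj
        linarith
      have h4 : dist x' y' ^ s ≤ (dist x y + 2 * D) ^ s * (b ^ s) ^ j := by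
        calc dist x' y' ^ s ≤ ((dist x y + 2 * D) * b ^ j) ^ s :=
              Real.rpow_le_rpow dist_nonneg hd hs.le
          _ = _ := by
              rw [Real.mul_rpow (by positivity) (by positivity),
                  ← Real.rpow_natCast b j, ← Real.rpow_natCast (b ^ s) j,
                  ← Real.rpow_mul hb0.le, ← Real.rpow_mul hb0.le, mul_comm s]
      have h5 : g x' + g y' ≤ 2 * t / 2 ^ j := by
        have e : 2 * t / 2 ^ j = t / 2 ^ j + t / 2 ^ j := by ring
        linarith
      calc dist x' y' ^ s * (g x' + g y')
          ≤ ((dist x y + 2 * D) ^ s * (b ^ s) ^ j) * (2 * t / 2 ^ j) :=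
            mul_le_mul h4 h5 (add_nonneg (hg0 _) (hg0 _)) (by positivity)
        _ = _ := by rw [div_pow]; ring
    have e1 := abs_sub_le (v x) (v x') (v y)
    have e2 := abs_sub_le (v x') (v y') (v y)
    rw [abs_sub_comm (v y) (v y')] at h2
    linarith
  have hlim : Filter.Tendsto (fun j : ℕ =>
      2 * B + ((dist x y + 2 * D) ^ s * (2 * t)) * (b ^ s / 2) ^ j) Filter.atTop
      (nhds (2 * B + ((dist x y + 2 * D) ^ s * (2 * t)) * 0)) := by
    refine tendsto_const_nhds.add (tendsto_const_nhds.mul ?_)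
    exact tendsto_pow_atTop_nhds_zero_of_lt_one (by positivity) (by linarith)
  have := ge_of_tendsto' hlim key
  simpa using this

/-- density step -/
lemma aux_density {n : ℕ} (hn : 0 < n) (g : Eu n → ℝ) (N : Set (Eu n)) (hN : volume N = 0)
    (A τ p : ℝ) (hA : 0 < A) (hτ : 0 < τ)
    (hM : volume {x | τ < g x} ≤ ENNReal.ofReal (A * τ ^ (-p))) (x : Eu n) :
    ∃ y, y ∉ N ∧ g y ≤ τ ∧
      dist x y ≤ (2 * A / (volume (ball (0 : Eu n) 1)).toReal) ^ (1 / (n : ℝ))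
        * τ ^ (-(p / n)) := by
  have hωt : volume (ball (0 : Eu n) 1) ≠ ⊤ := measure_ball_lt_top.ne
  have hω : 0 < (volume (ball (0 : Eu n) 1)).toReal :=
    ENNReal.toReal_pos (measure_ball_pos _ _ one_pos).ne' hωt
  set ω := (volume (ball (0 : Eu n) 1)).toReal with hωdef
  have hn' : (n : ℝ) ≠ 0 := by positivity
  set r := (2 * A / ω) ^ (1 / (n : ℝ)) * τ ^ (-(p / n)) with hr
  have hr0 : 0 < r := by positivity
  have hrn : r ^ n = 2 * A / ω * τ ^ (-p) := by
    rw [hr, mul_pow, ← Real.rpow_natCast, ← Real.rpow_natCast, ← Real.rpow_mul (by positivity),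
      ← Real.rpow_mul hτ.le]
    congr 1
    · rw [one_div_mul_cancel hn', Real.rpow_one]
    · congr 1; field_simp
  have hvol : volume (ball x r) = ENNReal.ofReal (2 * (A * τ ^ (-p))) := by
    rw [Measure.addHaar_ball_of_pos _ _ hr0, finrank_euclideanSpace, Fintype.card_fin, hrn,
      ← ENNReal.ofReal_toReal hωt, ← ENNReal.ofReal_mul (by positivity)]
    congr 1
    rw [← hωdef]
    field_simp
  by_contra hcon
  push Not at hcon
  have hsub : ball x r ⊆ N ∪ {x | τ < g x} := by
    intro y hy
    by_contra hy'
    simp only [mem_union, mem_ofPred_eq, not_or, not_lt] at hy'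
    have := hcon y hy'.1 hy'.2
    rw [mem_ball, dist_comm] at hy
    linarith
  have h1 : volume (ball x r) ≤ ENNReal.ofReal (A * τ ^ (-p)) := by
    calc _ ≤ volume N + volume {x | τ < g x} := (measure_mono hsub).trans (measure_union_le _ _)
      _ ≤ _ := by rw [hN, zero_add]; exact hM
  have hpos : 0 < A * τ ^ (-p) := by positivity
  rw [hvol, ENNReal.ofReal_le_ofReal_iff hpos.le] at h1
  linarith

/-- the constant in the oscillation estimate -/
def auxC (n : ℕ) (s p : ℝ) : ℝ :=
  4 * (2 / (volume (ball (0 : Eu n) 1)).toReal) ^ (s / (n : ℝ)) * ((2 : ℝ) ^ (p / n)) ^ s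
    / (1 - ((2 : ℝ) ^ (p / n)) ^ s / 2)

lemma aux_bs {n : ℕ} (hn : 0 < n) (s p : ℝ) (hps : p * s < n) :
    ((2 : ℝ) ^ (p / n)) ^ s < 2 := by
  rw [← Real.rpow_mul (by norm_num)]
  have hn' : (0 : ℝ) < n := by positivity
  calc (2 : ℝ) ^ (p / n * s) < 2 ^ (1 : ℝ) := by
        apply Real.rpow_lt_rpow_of_exponent_lt (by norm_num)
        rw [div_mul_eq_mul_div, div_lt_one hn']; exact hps
    _ = 2 := by simp

lemma auxC_pos {n : ℕ} (hn : 0 < n) (s p : ℝ) (hps : p * s < n) : 0 < auxC n s p := by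
  have hωt : volume (ball (0 : Eu n) 1) ≠ ⊤ := measure_ball_lt_top.ne
  have hω : 0 < (volume (ball (0 : Eu n) 1)).toReal :=
    ENNReal.toReal_pos (measure_ball_pos _ _ one_pos).ne' hωt
  have := aux_bs hn s p hps
  have : 0 < 1 - ((2 : ℝ) ^ (p / n)) ^ s / 2 := by linarith
  unfold auxC
  positivity

lemma aux_osc {n : ℕ} (hn : 0 < n) (s p L : ℝ) (hs : 0 < s) (hp : 0 < p) (hps : p * s < n)
    (hL : 0 < L) (v g : Eu n → ℝ) (hg : Measurable g) (hg0 : ∀ x, 0 ≤ g x)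
    (hgL : eLpNorm g (ENNReal.ofReal p) volume ≤ ENNReal.ofReal L)
    (N : Set (Eu n)) (hN : volume N = 0)
    (hv : ∀ x, x ∉ N → ∀ y, y ∉ N → |v x - v y| ≤ dist x y ^ s * (g x + g y))
    (x : Eu n) (hx : x ∉ N) (y : Eu n) (hy : y ∉ N) :
    |v x - v y| ≤ auxC n s p * L ^ (p * s / n) * max (g x) (g y) ^ (1 - p * s / n) := by
  have hn' : (0 : ℝ) < n := by positivity
  have hωt : volume (ball (0 : Eu n) 1) ≠ ⊤ := measure_ball_lt_top.ne
  have hω : 0 < (volume (ball (0 : Eu n) 1)).toReal :=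
    ENNReal.toReal_pos (measure_ball_pos _ _ one_pos).ne' hωt
  have hα : 0 < 1 - p * s / n := by
    rw [sub_pos, div_lt_one hn']; exact hps
  rcases (le_max_of_le_left (hg0 x) : 0 ≤ max (g x) (g y)).eq_or_lt with h0 | ht
  · have h1 : g x ≤ 0 := h0 ▸ le_max_left _ _
    have h2 : g y ≤ 0 := h0 ▸ le_max_right _ _
    have h3 : g x + g y = 0 := by linarith [hg0 x, hg0 y]
    rw [← h0, Real.zero_rpow hα.ne', mul_zero]
    have := hv x hx y hy
    rwa [h3, mul_zero] at this
  set t := max (g x) (g y) with htdef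
  have hbs := aux_bs hn s p hps
  have hb : 1 < (2 : ℝ) ^ (p / n) := Real.one_lt_rpow (by norm_num) (by positivity)
  have hpne : ENNReal.ofReal p ≠ 0 := by simpa using hp
  have hM : ∀ τ : ℝ, 0 < τ → volume {x | τ < g x} ≤ ENNReal.ofReal (L ^ p * τ ^ (-p)) := by
    intro τ hτ
    have h1 := mul_meas_ge_le_pow_eLpNorm' (volume : Measure (Eu n)) hpne ENNReal.ofReal_ne_top
      hg.aestronglyMeasurable (ENNReal.ofReal τ)
    rw [ENNReal.toReal_ofReal hp.le] at h1
    have h2 : eLpNorm g (ENNReal.ofReal p) volume ^ p ≤ ENNReal.ofReal (L ^ p) := by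
      rw [← ENNReal.ofReal_rpow_of_pos hL]
      exact ENNReal.rpow_le_rpow hgL hp.le
    have h3 : volume {x | τ < g x} ≤ volume {x | ENNReal.ofReal τ ≤ ‖g x‖ₑ} := by
      apply measure_mono
      intro z hz
      have hz' : τ < g z := hz
      show ENNReal.ofReal τ ≤ ‖g z‖ₑ
      rw [Real.enorm_of_nonneg (hg0 z)]
      exact ENNReal.ofReal_le_ofReal hz'.le
    rw [ENNReal.ofReal_rpow_of_pos hτ] at h1
    have hτp : 0 < τ ^ p := Real.rpow_pos_of_pos hτ p
    rw [Real.rpow_neg hτ.le, ← div_eq_mul_inv, ENNReal.ofReal_div_of_pos hτp]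
    refine h3.trans ?_
    rw [ENNReal.le_div_iff_mul_le (Or.inl (by simpa using hτp)) (Or.inl ENNReal.ofReal_ne_top),
      mul_comm]
    exact h1.trans h2
  set ω := (volume (ball (0 : Eu n) 1)).toReal with hωdef
  have hLp : 0 < L ^ p := Real.rpow_pos_of_pos hL p
  set R := (2 * L ^ p / ω) ^ (1 / (n : ℝ)) * t ^ (-(p / n)) with hR
  have hR0 : 0 < R := by positivity
  have main := aux_chain v g N s ((2 : ℝ) ^ (p / n)) t R hs hb hbs ht hR0 hg0 hv (by
    intro j z
    obtain ⟨w, hw1, hw2, hw3⟩ := aux_density hn g N hN (L ^ p) (t / 2 ^ j) p hLp (by positivity)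
      (hM _ (by positivity)) z
    refine ⟨w, hw1, hw2, hw3.trans_eq ?_⟩
    rw [hR, mul_assoc]
    congr 1
    rw [Real.div_rpow ht.le (by positivity), Real.rpow_neg (by positivity : (0 : ℝ) ≤ 2 ^ j),
      div_inv_eq_mul, ← Real.rpow_natCast, ← Real.rpow_natCast, ← Real.rpow_mul (by norm_num),
      ← Real.rpow_mul (by norm_num), mul_comm (p / n)]) x hx (le_max_left _ _) y hy
      (le_max_right _ _)
  refine main.trans_eq ?_
  have e1 : R ^ s = (2 / ω) ^ (s / (n : ℝ)) * L ^ (p * s / n) * t ^ (-(p * s / n)) := by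
    rw [hR, Real.mul_rpow (by positivity) (by positivity), ← Real.rpow_mul (by positivity),
      ← Real.rpow_mul ht.le, show 2 * L ^ p / ω = 2 / ω * L ^ p by ring,
      Real.mul_rpow (by positivity) (by positivity), ← Real.rpow_mul hL.le]
    congr 1
    · congr 1
      · congr 1; ring
      · congr 1; ring
    · congr 1; ring
  have e2 : t ^ (1 - p * s / n) = t ^ (-(p * s / n)) * t := by
    rw [sub_eq_neg_add, Real.rpow_add ht, Real.rpow_one]
  rw [Real.mul_rpow hR0.le (by positivity), e1, e2, auxC, ← hωdef]
  ring

lemma aux_avg {X : Type*} [MeasurableSpace X] (μ : Measure X) [IsFiniteMeasure μ] (hμ : μ ≠ 0)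
    (f : X → ℝ) (hf : AEStronglyMeasurable f μ) (q : ℝ) (hq : 1 ≤ q) (c : ℝ) :
    eLpNorm (fun x => f x - ⨍ y, f y ∂μ) (ENNReal.ofReal q) μ
      ≤ 2 * eLpNorm (fun x => f x - c) (ENNReal.ofReal q) μ := by
  have hq0 : 0 < q := by linarith
  have hq1 : (1 : ℝ≥0∞) ≤ ENNReal.ofReal q := by
    rw [← ENNReal.ofReal_one]; exact ENNReal.ofReal_le_ofReal hq
  set M := eLpNorm (fun x => f x - c) (ENNReal.ofReal q) μ with hM
  by_cases htop : M = ⊤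
  · rw [htop]; simp
  have hfc : AEStronglyMeasurable (fun x => f x - c) μ := hf.sub aestronglyMeasurable_const
  have hmem : MemLp (fun x => f x - c) (ENNReal.ofReal q) μ := ⟨hfc, lt_top_iff_ne_top.2 htop⟩
  have hint : Integrable (fun x => f x - c) μ := hmem.integrable hq1
  have hintf : Integrable f μ := by
    have := hint.add (integrable_const c)
    refine this.congr (Filter.Eventually.of_forall fun x => ?_)
    simp
  set m := ⨍ y, f y ∂μ with hm
  have : NeZero μ := ⟨hμ⟩
  have hμ0 : μ univ ≠ 0 := by simpa using hμ
  have hμt : μ univ ≠ ⊤ := measure_ne_top _ _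
  have hmc : ‖c - m‖ₑ ≤ (μ univ)⁻¹ * ∫⁻ x, ‖f x - c‖ₑ ∂μ := by
    have h1 : m - c = (μ.real univ)⁻¹ • ∫ x, (f x - c) ∂μ := by
      rw [hm, average_eq, integral_sub hintf (integrable_const c), integral_const, smul_sub,
        smul_smul, inv_mul_cancel₀, one_smul]
      exact (measureReal_ne_zero_iff hμt).2 hμ0
    rw [← enorm_neg, neg_sub, h1, enorm_smul]
    gcongr
    · rw [Real.enorm_of_nonneg (by positivity), ENNReal.ofReal_inv_of_pos
        (by rw [measureReal_def]; exact ENNReal.toReal_pos hμ0 hμt), measureReal_def,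
        ENNReal.ofReal_toReal hμt]
    · exact enorm_integral_le_lintegral_enorm _
  have hH := eLpNorm_le_eLpNorm_mul_rpow_measure_univ hq1 hfc
  rw [eLpNorm_one_eq_lintegral_enorm, ← hM, ENNReal.toReal_ofReal hq0.le] at hH
  have hconst : eLpNorm (fun _ : X => c - m) (ENNReal.ofReal q) μ ≤ M := by
    rw [eLpNorm_const' _ (by simpa using hq0) ENNReal.ofReal_ne_top, ENNReal.toReal_ofReal hq0.le]
    calc ‖c - m‖ₑ * μ univ ^ (1 / q)
        ≤ ((μ univ)⁻¹ * (M * μ univ ^ (1 / (1 : ℝ≥0∞).toReal - 1 / q))) * μ univ ^ (1 / q) := by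
          gcongr
          exact hmc.trans (by gcongr)
      _ = M * ((μ univ)⁻¹ * (μ univ ^ (1 / (1 : ℝ≥0∞).toReal - 1 / q) * μ univ ^ (1 / q))) := by
          ring
      _ = M := by
          rw [← ENNReal.rpow_add _ _ hμ0 hμt]
          simp [ENNReal.inv_mul_cancel hμ0 hμt]
  have hsplit : (fun x => f x - m) = (fun x => f x - c) + (fun _ : X => c - m) := by
    ext x; simp
  rw [hsplit, two_mul]
  exact (eLpNorm_add_le hfc aestronglyMeasurable_const hq1).trans (by gcongr)

lemma aux_Lq {n : ℕ} (hn : 0 < n) (s p L : ℝ) (hs : 0 < s) (hp : 0 < p) (hps : p * s < n)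
    (hL : 0 < L) (v g : Eu n → ℝ) (hg : Measurable g) (hg0 : ∀ x, 0 ≤ g x)
    (hgL : eLpNorm g (ENNReal.ofReal p) volume ≤ ENNReal.ofReal L)
    (N : Set (Eu n)) (hN : volume N = 0)
    (hv : ∀ x, x ∉ N → ∀ y, y ∉ N → |v x - v y| ≤ dist x y ^ s * (g x + g y))
    (Ω : Set (Eu n)) (hΩm : MeasurableSet Ω) (hΩ0 : volume Ω ≠ 0) (hΩt : volume Ω ≠ ⊤) :
    ∃ c : ℝ, eLpNorm (fun x => v x - c) (ENNReal.ofReal (p * n / (n - p * s)))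
      (volume.restrict Ω) ≤
        ENNReal.ofReal (auxC n s p * 2 ^ (1 / (p * n / (n - p * s)))) * ENNReal.ofReal L := by
  have hn' : (0 : ℝ) < n := by positivity
  have hd : 0 < n - p * s := by linarith
  have hpne : ENNReal.ofReal p ≠ 0 := by simpa using hp
  set q := p * n / (n - p * s) with hq
  have hq0 : 0 < q := by positivity
  have hLp : 0 < L ^ p := Real.rpow_pos_of_pos hL p
  have hC := auxC_pos hn s p hps
  have hα : 0 < 1 - p * s / n := by
    rw [sub_pos, div_lt_one hn']; exact hps
  have hαq : (1 - p * s / n) * q = p := by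
    rw [hq]; field_simp
  -- integral of g^p
  have hI : ∫⁻ x in Ω, ENNReal.ofReal (g x ^ p) ≤ ENNReal.ofReal (L ^ p) := by
    have h1 : ∫⁻ x, ENNReal.ofReal (g x ^ p) ≤ ENNReal.ofReal (L ^ p) := by
      rw [eLpNorm_eq_lintegral_rpow_enorm_toReal hpne ENNReal.ofReal_ne_top,
        ENNReal.toReal_ofReal hp.le, one_div, ENNReal.rpow_inv_le_iff hp,
        ENNReal.ofReal_rpow_of_pos hL] at hgL
      refine le_trans (le_of_eq ?_) hgL
      refine lintegral_congr fun x => ?_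
      rw [Real.enorm_of_nonneg (hg0 x), ENNReal.ofReal_rpow_of_nonneg (hg0 x) hp.le]
    exact (setLIntegral_le_lintegral _ _).trans h1
  have hfin : IsFiniteMeasure (volume.restrict Ω) := ⟨by simpa using hΩt.lt_top⟩
  have hne : volume.restrict Ω ≠ 0 := by
    rw [Ne, Measure.restrict_eq_zero]; exact hΩ0
  have hNr : (volume.restrict Ω) N = 0 := by
    exact le_antisymm ((Measure.restrict_apply_le _ _).trans hN.le) bot_le
  have hgm : Measurable fun x => ENNReal.ofReal (g x ^ p) :=
    (hg.pow_const p).ennreal_ofReal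
  obtain ⟨y, hyN, hy⟩ := exists_notMem_null_le_laverage hne hgm.aemeasurable hNr
  have hy' : ENNReal.ofReal (g y ^ p) * volume Ω ≤ ENNReal.ofReal (L ^ p) := by
    rw [laverage_eq, Measure.restrict_apply_univ] at hy
    exact ((ENNReal.le_div_iff_mul_le (Or.inl hΩ0) (Or.inl hΩt)).1 hy).trans hI
  refine ⟨v y, ?_⟩
  set D := auxC n s p * L ^ (p * s / n) with hD
  have hD0 : 0 < D := by positivity
  rw [eLpNorm_eq_lintegral_rpow_enorm_toReal (by simpa using hq0) ENNReal.ofReal_ne_top,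
    ENNReal.toReal_ofReal hq0.le, one_div, ENNReal.rpow_inv_le_iff hq0]
  have hae : ∀ᵐ x ∂(volume.restrict Ω), ‖v x - v y‖ₑ ^ q ≤
      ENNReal.ofReal (D ^ q) * (ENNReal.ofReal (g x ^ p) + ENNReal.ofReal (g y ^ p)) := by
    have : ∀ᵐ x ∂(volume.restrict Ω), x ∉ N := measure_eq_zero_iff_ae_notMem.1 hNr
    filter_upwards [this] with x hx
    have h1 := aux_osc hn s p L hs hp hps hL v g hg hg0 hgL N hN hv x hx y hyN
    rw [← hD] at h1
    have hmax : 0 ≤ max (g x) (g y) := le_max_of_le_left (hg0 x)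
    have hgx := Real.rpow_nonneg (hg0 x) p
    have hgy := Real.rpow_nonneg (hg0 y) p
    rw [← ENNReal.ofReal_add hgx hgy, ← ENNReal.ofReal_mul (by positivity),
      Real.enorm_eq_ofReal_abs, ENNReal.ofReal_rpow_of_nonneg (abs_nonneg _) hq0.le]
    apply ENNReal.ofReal_le_ofReal
    calc |v x - v y| ^ q ≤ (D * max (g x) (g y) ^ (1 - p * s / n)) ^ q :=
          Real.rpow_le_rpow (abs_nonneg _) h1 hq0.le
      _ = D ^ q * max (g x) (g y) ^ p := by
          rw [Real.mul_rpow hD0.le (by positivity), ← Real.rpow_mul hmax, hαq]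
      _ ≤ D ^ q * (g x ^ p + g y ^ p) := by
          gcongr
          rcases max_choice (g x) (g y) with h | h <;> rw [h] <;> linarith
  refine (lintegral_mono_ae hae).trans ?_
  rw [lintegral_const_mul' _ _ ENNReal.ofReal_ne_top, lintegral_add_left hgm, lintegral_const,
    Measure.restrict_apply_univ, ← ENNReal.ofReal_mul (by positivity),
    ENNReal.ofReal_rpow_of_pos (by positivity)]
  calc _ ≤ ENNReal.ofReal (D ^ q) * (ENNReal.ofReal (L ^ p) + ENNReal.ofReal (L ^ p)) := by
        gcongr
    _ = ENNReal.ofReal (D ^ q * (2 * L ^ p)) := by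
        rw [← ENNReal.ofReal_add hLp.le hLp.le, ← ENNReal.ofReal_mul (by positivity), two_mul]
    _ ≤ _ := by
        apply ENNReal.ofReal_le_ofReal
        apply le_of_eq
        rw [hD, Real.mul_rpow (by positivity) hL.le, Real.mul_rpow hC.le (by positivity),
          Real.mul_rpow hC.le (by positivity), ← Real.rpow_mul (by norm_num : (0 : ℝ) ≤ 2),
          inv_mul_cancel₀ hq0.ne', Real.rpow_one, ← Real.rpow_mul hL.le]
        have e : L ^ q = L ^ (p * s / n * q) * L ^ p := by
          rw [← Real.rpow_add hL]
          congr 1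
          linarith
        rw [e]; ring

/-- Every bounded `Ṁ^{s,p}_ball`-extension domain supports a
`(pn/(n-ps), p)_s`-HSP imbedding. -/
theorem stmt12 {n : ℕ} (hn : 2 ≤ n) (s p : ℝ) (hs : s ∈ Set.Ioc (0:ℝ) 1)
    (hp : (n : ℝ) / (n + s) < p) (hp' : p < (n : ℝ) / s)
    (Ω : Set (Eu n)) (hΩ : IsDomainEu Ω) (hbd : Bornology.IsBounded Ω)
    (hext : IsMballExtensionDomain Ω s p) :
    SupportsHSP Ω s p := by
  obtain ⟨hs0, hs1⟩ := hs
  have hn0 : 0 < n := by omega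
  have hn' : (0 : ℝ) < n := by positivity
  have hp0 : 0 < p := lt_trans (by positivity) hp
  have hps : p * s < n := (lt_div_iff₀ hs0).1 hp'
  have hd : 0 < n - p * s := by linarith
  have hq1 : 1 ≤ p * n / (n - p * s) := by
    rw [le_div_iff₀ hd]
    have := (div_lt_iff₀ (by positivity)).1 hp
    linarith
  have hC := auxC_pos hn0 s p hps
  obtain ⟨C₀, hC₀, hC₀ext⟩ := hext
  have hΩ0 : volume Ω ≠ 0 := (hΩ.1.measure_pos volume hΩ.2.nonempty).ne'
  have hΩt : volume Ω ≠ ⊤ := hbd.measure_lt_top.ne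
  have hfin : IsFiniteMeasure (volume.restrict Ω) := ⟨by simpa using hΩt.lt_top⟩
  have hne : volume.restrict Ω ≠ 0 := by
    rw [Ne, Measure.restrict_eq_zero]; exact hΩ0
  set K := auxC n s p * 2 ^ (1 / (p * n / (n - p * s))) with hK
  have hK0 : 0 < K := by positivity
  refine ⟨2 * K * C₀, by positivity, fun u hu => ?_⟩
  obtain ⟨v, hv, hvu, hvn⟩ := hC₀ext u hu
  have hX : ENNReal.ofReal (2 * K * C₀) * ballNorm Ω s p u
      = ENNReal.ofReal (2 * K) * (ENNReal.ofReal C₀ * ballNorm Ω s p u) := by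
    rw [ENNReal.ofReal_mul (by positivity), mul_assoc]
  rw [hX]
  have hfinX : ENNReal.ofReal C₀ * ballNorm Ω s p u ≠ ⊤ :=
    ENNReal.mul_ne_top ENNReal.ofReal_ne_top hu.2.ne
  set Y := ENNReal.ofReal C₀ * ballNorm Ω s p u with hY
  have hK2 : ENNReal.ofReal (2 * K) ≠ 0 := by
    simpa using hK0
  rw [← ENNReal.div_le_iff' hK2 ENNReal.ofReal_ne_top]
  refine le_of_forall_gt_imp_ge_of_dense fun Z hZ => ?_
  rw [ENNReal.div_le_iff' hK2 ENNReal.ofReal_ne_top]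
  by_cases hZt : Z = ⊤
  · rw [hZt, ENNReal.mul_top hK2]; exact le_top
  have hlt : ballNorm univ s p v < Z := hvn.trans_lt hZ
  unfold ballNorm ballNormRho at hlt
  obtain ⟨g, hlt⟩ := iInf_lt_iff.1 hlt
  obtain ⟨hgD, hlt⟩ := iInf_lt_iff.1 hlt
  obtain ⟨hgm, hg0, N, -, hN0, hgrad⟩ := hgD
  rw [Measure.restrict_univ] at hlt
  have hZ0 : Z ≠ 0 := (bot_le.trans_lt hlt).ne'
  have hL : 0 < Z.toReal := ENNReal.toReal_pos hZ0 hZt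
  have hgrad' : ∀ x, x ∉ N → ∀ y, y ∉ N → |v x - v y| ≤ dist x y ^ s * (g x + g y) := by
    intro x hx y hy
    refine hgrad x ⟨mem_univ _, hx⟩ y ⟨mem_univ _, hy⟩ ?_
    have : EMetric.infEdist x (univᶜ : Set (Eu n)) = ⊤ := by
      rw [compl_univ]; exact infEDist_empty
    rw [this, ENNReal.mul_top (by norm_num)]
    exact edist_lt_top _ _
  obtain ⟨c, hc⟩ := aux_Lq hn0 s p Z.toReal hs0 hp0 hps hL v g hgm hg0
    (by rw [ENNReal.ofReal_toReal hZt]; exact hlt.le) N hN0 hgrad' Ω hΩ.1.measurableSet hΩ0 hΩt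
  rw [ENNReal.ofReal_toReal hZt, ← hK] at hc
  have hcu : eLpNorm (fun x => u x - c) (ENNReal.ofReal (p * n / (n - p * s)))
      (volume.restrict Ω) ≤ ENNReal.ofReal K * Z := by
    refine le_trans (le_of_eq (eLpNorm_congr_ae ?_)) hc
    filter_upwards [ae_restrict_mem hΩ.1.measurableSet] with x hx
    rw [hvu x hx]
  refine (aux_avg (volume.restrict Ω) hne u hu.1.aestronglyMeasurable _ hq1 c).trans ?_
  rw [ENNReal.ofReal_mul (by norm_num), mul_assoc]
  simpa using mul_le_mul_right hcu 2
end
end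

section
/- Let n ≥ 2 and s ∈ (0,1]. There exist constants 0 < C₁ < 1 < C₂ such that for every ball B ⊆ ℝⁿ and every nonconstant u ∈ Ṁ^{s,n/s}(4B): (1/|B|) ∫_B exp( ( C₁ |u(x) − u_B| / ‖u‖_{Ṁ^{s,n/s}(4B)} )^{n/(n−s)} ) dx ≤ C₂, where u_B := (1/|B|) ∫_B u and 4B is the ball concentric with B of 4 times the radius. -/
open MeasureTheory Metric Set
open scoped ENNReal

noncomputable section

lemma aux_layer (a : ℕ → ℝ) (ha : ∀ k, 0 ≤ a k) (h2 : ∀ k, 2 * a k ≤ a (k+1)) (G : ℝ)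
    (hG : 0 ≤ G) (K : ℕ) :
    ∑ k ∈ Finset.range K, (if a k < G then a k else 0) ≤ 2 * G := by
  have geo : ∀ K, ∑ k ∈ Finset.range (K+1), a k ≤ 2 * a K := by
    intro K
    induction K with
    | zero => simp; linarith [ha 0]
    | succ K ih => rw [Finset.sum_range_succ]; linarith [h2 K]
  induction K with
  | zero => simpa using hG
  | succ K ih =>
    by_cases h : a K < G
    · calc _ ≤ ∑ k ∈ Finset.range (K+1), a k := by
            apply Finset.sum_le_sum; intro k _; split_ifs; exacts [le_rfl, ha k]
        _ ≤ 2 * a K := geo K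
        _ ≤ _ := by linarith
    · rw [Finset.sum_range_succ, if_neg h]; linarith

lemma aux_holder (α : ℝ) (h0 : 0 < α) (h1 : α < 1) (θ : ℕ → ℝ) (hθ : ∀ k, 0 ≤ θ k) (k : ℕ)
    (h4 : ∑ j ∈ Finset.range k, θ j ≤ 4) :
    ∑ j ∈ Finset.range k, θ j ^ α ≤ 4 * (k:ℝ) ^ (1 - α) := by
  have hc : Real.HolderConjugate (1/α) (1/(1-α)) := by
    rw [Real.holderConjugate_iff]
    refine ⟨by rw [lt_div_iff₀ h0]; linarith, by simp⟩
  have := Real.inner_le_Lp_mul_Lq_of_nonneg (Finset.range k) hc (f := fun j => θ j ^ α)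
    (g := fun _ => 1) (fun j _ => Real.rpow_nonneg (hθ j) _) (fun _ _ => zero_le_one)
  have e : ∀ j, (θ j ^ α) ^ (1/α) = θ j := fun j => by
    rw [← Real.rpow_mul (hθ j), mul_one_div_cancel h0.ne', Real.rpow_one]
  simp only [mul_one, e, Real.one_rpow, Finset.sum_const, Finset.card_range, nsmul_eq_mul,
    one_div_one_div] at this
  refine this.trans ?_
  gcongr
  have hs : 0 ≤ ∑ j ∈ Finset.range k, θ j := Finset.sum_nonneg fun j _ => hθ j
  calc _ ≤ (4:ℝ) ^ α := Real.rpow_le_rpow hs h4 h0.le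
    _ ≤ (4:ℝ) ^ (1:ℝ) := Real.rpow_le_rpow_of_exponent_le (by norm_num) h1.le
    _ = 4 := by simp

/-- finite sums of level-set measures -/
lemma aux_levels {n : ℕ} (U : Set (Eu n)) (g : Eu n → ℝ)
    (hg : Measurable g) (hg0 : ∀ x, 0 ≤ g x) (p : ℝ) (hp : 1 ≤ p) (M : ℝ)
    (hI : ∫⁻ x in U, ENNReal.ofReal (g x ^ p) ≤ ENNReal.ofReal (M ^ p)) (l : ℝ) (hl : 0 < l)
    (K : ℕ) :
    ∑ k ∈ Finset.range K, ENNReal.ofReal ((l * 2 ^ k) ^ p) * volume {y ∈ U | l * 2 ^ k < g y}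
      ≤ ENNReal.ofReal (2 * M ^ p) := by
  have hlk : ∀ k : ℕ, 0 < l * 2 ^ k := fun k => by positivity
  have hms : ∀ k : ℕ, MeasurableSet {y | l * 2 ^ k < g y} := fun k =>
    measurableSet_lt measurable_const hg
  have h1 : ∀ k : ℕ, ENNReal.ofReal ((l * 2 ^ k) ^ p) * volume {y ∈ U | l * 2 ^ k < g y}
      = ∫⁻ x in U, {y | l * 2 ^ k < g y}.indicator
          (fun _ => ENNReal.ofReal ((l * 2 ^ k) ^ p)) x := by
    intro k
    rw [lintegral_indicator_const (hms k), Measure.restrict_apply (hms k), Set.inter_comm]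
    rfl
  rw [Finset.sum_congr rfl fun k _ => h1 k, ← lintegral_finsetSum]
  swap
  · intro k _
    exact measurable_const.indicator (hms k)
  calc _ ≤ ∫⁻ x in U, 2 * ENNReal.ofReal (g x ^ p) := by
        apply lintegral_mono
        intro x
        have h0 := aux_layer (fun k => (l * 2 ^ k) ^ p) (fun k => by positivity)
          (fun k => by
            have : l * 2 ^ (k+1) = 2 * (l * 2 ^ k) := by ring
            simp only [this]
            rw [Real.mul_rpow (by norm_num) (hlk k).le]
            gcongr
            calc (2:ℝ) = 2 ^ (1:ℝ) := by simp
              _ ≤ _ := Real.rpow_le_rpow_of_exponent_le (by norm_num) hp)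
          (g x ^ p) (Real.rpow_nonneg (hg0 x) _) K
        have h2 : (2 : ℝ≥0∞) * ENNReal.ofReal (g x ^ p) = ENNReal.ofReal (2 * g x ^ p) := by
          rw [ENNReal.ofReal_mul (by norm_num)]; simp
        simp only [h2]
        refine le_trans ?_ (ENNReal.ofReal_le_ofReal h0)
        rw [ENNReal.ofReal_sum_of_nonneg
          (by intro i _; split_ifs; exacts [by positivity, le_rfl])]
        apply Finset.sum_le_sum
        intro k _
        by_cases h : l * 2 ^ k < g x
        · have : (l * 2 ^ k) ^ p < g x ^ p := Real.rpow_lt_rpow (hlk k).le h (by linarith)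
          simp [Set.indicator, h, this]
        · simp [Set.indicator, h]
    _ = 2 * ∫⁻ x in U, ENNReal.ofReal (g x ^ p) := by
        rw [lintegral_const_mul]
        exact (hg.pow_const p).ennreal_ofReal
    _ ≤ 2 * ENNReal.ofReal (M ^ p) := by gcongr
    _ = _ := by rw [ENNReal.ofReal_mul (by norm_num)]; simp

lemma aux_chain_s16 {n : ℕ} (s : ℝ) (hs : 0 < s) (x₀ : Eu n) (r : ℝ) (hr : 0 < r) (u g : Eu n → ℝ)
    (hg0 : ∀ x, 0 ≤ g x) (N : Set (Eu n)) (hN : volume N = 0)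
    (hug : ∀ x ∈ ball x₀ (4*r) \ N, ∀ y ∈ ball x₀ (4*r) \ N,
      |u x - u y| ≤ dist x y ^ s * (g x + g y))
    (l : ℝ) (hl : 0 < l) (δ : ℕ → ℝ) (hδ0 : ∀ k, 0 < δ k)
    (hδ1 : ∀ k, δ k ≤ (1/2) ^ (k+1))
    (hv : ∀ k : ℕ, ∀ x : Eu n, volume {y ∈ ball x₀ (4*r) | l * 2 ^ k < g y} < volume (ball x (r * δ k))) :
    ∃ c : ℝ, ∀ k : ℕ, ∀ x ∈ ball x₀ (r * (1 + (1/2) ^ k)) \ N, g x ≤ l * 2 ^ k →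
      |u x - c| ≤ (4*r) ^ s * (2 * l) +
        ∑ j ∈ Finset.range k, (r * δ j) ^ s * (4 * (l * 2 ^ j)) := by
  have hhalf : ∀ k : ℕ, ((1:ℝ)/2) ^ k ≤ 1 := fun k => pow_le_one₀ (by norm_num) (by norm_num)
  have hsub : ∀ k : ℕ, ball x₀ (r * (1 + (1/2) ^ k)) ⊆ ball x₀ (4*r) := fun k =>
    ball_subset_ball (by nlinarith [hhalf k])
  obtain ⟨c, hc⟩ : ∃ c : ℝ, ∀ x ∈ ball x₀ (r * (1 + (1/2) ^ 0)) \ N, g x ≤ l * 2 ^ 0 →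
      |u x - c| ≤ (4*r) ^ s * (2 * l) := by
    by_cases h : ∃ y ∈ ball x₀ (r * (1 + (1/2) ^ 0)) \ N, g y ≤ l * 2 ^ 0
    · obtain ⟨y, hy, hgy⟩ := h
      refine ⟨u y, fun x hx hgx => ?_⟩
      refine (hug x ⟨hsub 0 hx.1, hx.2⟩ y ⟨hsub 0 hy.1, hy.2⟩).trans ?_
      have hd : dist x y ≤ 4 * r := by
        have h1 := mem_ball.1 hx.1
        have h2 := mem_ball.1 hy.1
        have := dist_triangle_right x y x₀
        norm_num at h1 h2
        linarith
      apply mul_le_mul (Real.rpow_le_rpow dist_nonneg hd hs.le) (by linarith)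
        (add_nonneg (hg0 _) (hg0 _)) (by positivity)
    · push Not at h
      exact ⟨0, fun x hx hgx => absurd (h x hx) (not_lt.2 hgx)⟩
  refine ⟨c, fun k => ?_⟩
  induction k with
  | zero => simpa using hc
  | succ k ih =>
    intro x hx hgx
    have hxd := mem_ball.1 hx.1
    have hy : ∃ y ∈ ball x (r * δ k), y ∉ {y ∈ ball x₀ (4*r) | l * 2 ^ k < g y} ∪ N := by
      by_contra hcon
      push Not at hcon
      have h1 : volume (ball x (r * δ k)) ≤ volume {y ∈ ball x₀ (4*r) | l * 2 ^ k < g y} := by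
        calc _ ≤ volume ({y ∈ ball x₀ (4*r) | l * 2 ^ k < g y} ∪ N) := measure_mono hcon
          _ ≤ _ := measure_union_le _ _
          _ = _ := by rw [hN, add_zero]
      exact absurd (hv k x) (not_lt.2 h1)
    obtain ⟨y, hyx, hyn⟩ := hy
    have hyd := mem_ball.1 hyx
    have hyb : y ∈ ball x₀ (r * (1 + (1/2) ^ k)) := by
      rw [mem_ball]
      have e : ((1:ℝ)/2) ^ (k+1) = (1/2)^k / 2 := by ring
      have h1 := hδ1 k
      have h2 := mul_le_mul_of_nonneg_left h1 hr.le
      rw [e] at h2 hxd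
      have := dist_triangle y x x₀
      nlinarith
    have hyN : y ∉ N := fun h => hyn (Or.inr h)
    have hgy : g y ≤ l * 2 ^ k := by
      by_contra h
      exact hyn (Or.inl ⟨hsub k hyb, not_le.1 h⟩)
    have h1 := ih y ⟨hyb, hyN⟩ hgy
    have h2 := hug x ⟨hsub _ hx.1, hx.2⟩ y ⟨hsub k hyb, hyN⟩
    have h3 : dist x y ^ s * (g x + g y) ≤ (r * δ k) ^ s * (4 * (l * 2 ^ k)) := by
      have hp : 0 < l * 2 ^ k := by positivity
      apply mul_le_mul (Real.rpow_le_rpow dist_nonneg (by rw [dist_comm]; exact hyd.le) hs.le) _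
        (add_nonneg (hg0 _) (hg0 _)) (Real.rpow_nonneg (mul_pos hr (hδ0 k)).le _)
      have : l * 2 ^ (k+1) = 2 * (l * 2 ^ k) := by ring
      linarith
    rw [Finset.sum_range_succ]
    have := abs_sub_le (u x) (u y) c
    linarith

lemma aux_params {n : ℕ} (hn : 2 ≤ n) (s : ℝ) (hs : s ∈ Set.Ioc (0:ℝ) 1) (A : ℝ) (hA : 0 < A)
    (hAp : A ^ ((n:ℝ)/s) * (volume (ball (0 : Eu n) 1)).toReal = 2 ^ (n+2))
    (x₀ : Eu n) (r : ℝ) (hr : 0 < r) (u g : Eu n → ℝ) (hg : Measurable g)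
    (hg0 : ∀ x, 0 ≤ g x) (N : Set (Eu n)) (hN : volume N = 0)
    (hug : ∀ x ∈ ball x₀ (4*r) \ N, ∀ y ∈ ball x₀ (4*r) \ N,
      |u x - u y| ≤ dist x y ^ s * (g x + g y)) (M : ℝ) (hM : 0 < M)
    (hI : ∫⁻ x in ball x₀ (4*r), ENNReal.ofReal (g x ^ ((n:ℝ)/s))
      ≤ ENNReal.ofReal (M ^ ((n:ℝ)/s))) :
    ∃ c : ℝ, ∀ k : ℕ, ∀ x ∈ ball x₀ r \ N, g x ≤ (A * M * r ^ (-s)) * 2 ^ k →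
      |u x - c| ≤ (24 * A + 1) * M * ((k:ℝ)+1) ^ (1 - s / n) := by
  obtain ⟨hs0, hs1⟩ := hs
  have hn2 : (2:ℝ) ≤ n := by exact_mod_cast hn
  have hn0 : (0:ℝ) < n := by linarith
  set p : ℝ := (n:ℝ)/s with hp
  have hpn : (n:ℝ) ≤ p := by rw [hp, le_div_iff₀ hs0]; nlinarith
  have hp1 : 1 ≤ p := by linarith
  have hp0 : 0 < p := by linarith
  have hsp : s * p = n := by rw [hp]; field_simp
  set ω := (volume (ball (0 : Eu n) 1)).toReal with hω
  have hωtop : volume (ball (0 : Eu n) 1) ≠ ⊤ := measure_ball_lt_top.ne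
  have hω0 : 0 < ω := ENNReal.toReal_pos (measure_ball_pos _ _ one_pos).ne' hωtop
  set l := A * M * r ^ (-s) with hldef
  have hl : 0 < l := by positivity
  have hlp : l ^ p * (ω * r ^ n) = 2 ^ (n+2) * M ^ p := by
    have e1 : (r ^ (-s)) ^ p = (r ^ n)⁻¹ := by
      rw [← Real.rpow_mul hr.le, neg_mul, hsp, Real.rpow_neg hr.le, Real.rpow_natCast]
    rw [hldef, Real.mul_rpow (by positivity) (by positivity), Real.mul_rpow hA.le hM.le, e1, ← hAp]
    field_simp
  have hMp : 0 < M ^ p := by positivity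
  have hlev := aux_levels (ball x₀ (4*r)) g hg hg0 p hp1 M hI l hl
  set S : ℕ → Set (Eu n) := fun k => {y ∈ ball x₀ (4*r) | l * 2 ^ k < g y} with hS
  have hStop : ∀ k, volume (S k) ≠ ⊤ := fun k =>
    ne_top_of_le_ne_top measure_ball_lt_top.ne (measure_mono (fun y hy => hy.1) :
      volume (S k) ≤ volume (ball x₀ (4*r)))
  set m : ℕ → ℝ := fun k => (volume (S k)).toReal with hm
  have hm0 : ∀ k, 0 ≤ m k := fun k => ENNReal.toReal_nonneg
  have hmS : ∀ k, volume (S k) = ENNReal.ofReal (m k) := fun k =>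
    (ENNReal.ofReal_toReal (hStop k)).symm
  have hsum : ∀ K, ∑ k ∈ Finset.range K, (l * 2 ^ k) ^ p * m k ≤ 2 * M ^ p := by
    intro K
    have h := hlev K
    rw [Finset.sum_congr rfl (fun k _ => by
      rw [show {y ∈ ball x₀ (4*r) | l * 2 ^ k < g y} = S k from rfl, hmS k,
        ← ENNReal.ofReal_mul (by positivity)]),
      ← ENNReal.ofReal_sum_of_nonneg (fun k _ => mul_nonneg (by positivity) (hm0 k)),
      ENNReal.ofReal_le_ofReal_iff (by positivity)] at h
    exact h
  set θ : ℕ → ℝ := fun k => (l * 2 ^ k) ^ p * m k / M ^ p + (1/2) ^ k with hθ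
  have hθ0 : ∀ k, 0 < θ k := fun k =>
    add_pos_of_nonneg_of_pos (div_nonneg (mul_nonneg (by positivity) (hm0 k)) hMp.le) (by positivity)
  have hθs : ∀ K, ∑ k ∈ Finset.range K, θ k ≤ 4 := by
    intro K
    rw [hθ, Finset.sum_add_distrib, ← Finset.sum_div]
    have h1 : (∑ k ∈ Finset.range K, (l * 2 ^ k) ^ p * m k) / M ^ p ≤ 2 := by
      rw [div_le_iff₀ hMp]; exact hsum K
    have h2 : ∑ k ∈ Finset.range K, ((1:ℝ)/2) ^ k ≤ 2 := by
      exact sum_geometric_two_le K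
    linarith
  have hθ4 : ∀ k, θ k ≤ 4 := fun k =>
    (Finset.single_le_sum (fun j _ => (hθ0 j).le) (Finset.self_mem_range_succ k)).trans (hθs (k+1))
  set D : ℕ → ℝ := fun k => 2 ^ (n+2) * ((2:ℝ) ^ k) ^ p with hD
  have hD0 : ∀ k, 0 < D k := fun k => by positivity
  set δ : ℕ → ℝ := fun k => (θ k / D k) ^ (1 / (n:ℝ)) with hδ
  have hδ0 : ∀ k, 0 < δ k := fun k => Real.rpow_pos_of_pos (div_pos (hθ0 k) (hD0 k)) _
  have hδn : ∀ k, δ k ^ n = θ k / D k := fun k => by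
    rw [hδ, ← Real.rpow_natCast, ← Real.rpow_mul (div_pos (hθ0 k) (hD0 k)).le,
      one_div_mul_cancel hn0.ne', Real.rpow_one]
  have hδ1 : ∀ k, δ k ≤ (1/2) ^ (k+1) := by
    intro k
    refine le_of_pow_le_pow_left₀ (n := n) (by omega) (by positivity) ?_
    rw [hδn, div_le_iff₀ (hD0 k)]
    have h1 : ((2:ℝ)^k)^n ≤ ((2:ℝ)^k)^p := by
      rw [← Real.rpow_natCast (((2:ℝ)^k)) n]
      exact Real.rpow_le_rpow_of_exponent_le (one_le_pow₀ (by norm_num)) hpn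
    calc θ k ≤ 4 := hθ4 k
      _ = (((1:ℝ)/2)^(k+1))^n * (2^(n+2) * ((2:ℝ)^k)^n) := by
        have : (((1:ℝ)/2)^(k+1)) = 1 / (2 * 2^k) := by rw [pow_succ, div_pow]; field_simp; simp
        rw [this, div_pow, mul_pow]; field_simp; ring
      _ ≤ _ := by simp only [hD]; gcongr
  have hv : ∀ k : ℕ, ∀ x : Eu n, volume {y ∈ ball x₀ (4*r) | l * 2 ^ k < g y} < volume (ball x (r * δ k)) := by
    intro k x
    rw [show {y ∈ ball x₀ (4*r) | l * 2 ^ k < g y} = S k from rfl, hmS k,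
      Measure.addHaar_ball_of_pos _ _ (mul_pos hr (hδ0 k)), ← ENNReal.ofReal_toReal hωtop,
      ← ENNReal.ofReal_mul (pow_nonneg (mul_pos hr (hδ0 k)).le _), finrank_euclideanSpace_fin,
      mul_pow, hδn, ← hω]
    rw [ENNReal.ofReal_lt_ofReal_iff (by have := hθ0 k; have := hD0 k; positivity)]
    have h1 : (l * 2 ^ k) ^ p * m k / M ^ p < θ k := by
      have : (0:ℝ) < (1/2)^k := by positivity
      simp only [hθ]; linarith
    have e : r ^ n * (θ k / D k) * ω = θ k * M ^ p / (l * 2 ^ k) ^ p := by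
      rw [Real.mul_rpow hl.le (by positivity), hD]
      field_simp
      linear_combination (θ k) * hlp
    rw [e, lt_div_iff₀ (by positivity)]
    rw [div_lt_iff₀ hMp] at h1
    linarith
  obtain ⟨c, hc⟩ := aux_chain_s16 s hs0 x₀ r hr u g hg0 N hN hug l hl δ hδ0 hδ1 hv
  refine ⟨c, fun k x hx hgx => ?_⟩
  have hrs : r ^ s * r ^ (-s) = 1 := by rw [← Real.rpow_add hr]; simp
  have hx' : x ∈ ball x₀ (r * (1 + (1/2) ^ k)) \ N := by
    refine ⟨ball_subset_ball ?_ hx.1, hx.2⟩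
    have : (0:ℝ) < (1/2)^k := by positivity
    nlinarith
  refine (hc k x hx' hgx).trans ?_
  have hα0 : 0 < s / n := by positivity
  have hα1 : s / n < 1 := by rw [div_lt_one hn0]; linarith
  have t1 : (4*r) ^ s * (2 * l) ≤ 8 * A * M := by
    rw [Real.mul_rpow (by norm_num) hr.le, hldef]
    have : (4:ℝ) ^ s ≤ 4 ^ (1:ℝ) := Real.rpow_le_rpow_of_exponent_le (by norm_num) hs1
    rw [Real.rpow_one] at this
    calc _ = 4 ^ s * (2 * A * M) * (r ^ s * r ^ (-s)) := by ring
      _ = 4 ^ s * (2 * A * M) := by rw [hrs, mul_one]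
      _ ≤ 4 * (2 * A * M) := by gcongr
      _ = _ := by ring
  have t2 : ∀ j, (r * δ j) ^ s * (4 * (l * 2 ^ j)) ≤ 4 * A * M * θ j ^ (s / n) := by
    intro j
    have hδs : δ j ^ s * 2 ^ j ≤ θ j ^ (s/n) := by
      have e1 : δ j ^ s = θ j ^ (s/n) / D j ^ (s/n) := by
        rw [hδ, ← Real.rpow_mul (div_pos (hθ0 j) (hD0 j)).le,
          Real.div_rpow (hθ0 j).le (hD0 j).le]
        congr 2 <;> ring
      have e2 : (2:ℝ) ^ j ≤ D j ^ (s/n) := by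
        have e3 : (((2:ℝ)^j)^p)^(s/n) = 2^j := by
          rw [← Real.rpow_mul (by positivity), hp, div_mul_div_cancel₀ hs0.ne', div_self hn0.ne',
            Real.rpow_one]
        calc (2:ℝ)^j = (((2:ℝ)^j)^p)^(s/n) := e3.symm
          _ ≤ _ := by
            apply Real.rpow_le_rpow (by positivity) _ hα0.le
            rw [hD]
            have : (1:ℝ) ≤ 2^(n+2) := one_le_pow₀ (by norm_num)
            exact le_mul_of_one_le_left (by positivity) this
      rw [e1, div_mul_eq_mul_div, div_le_iff₀ (Real.rpow_pos_of_pos (hD0 j) _)]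
      have := Real.rpow_nonneg (hθ0 j).le (s/n)
      gcongr
    rw [Real.mul_rpow hr.le (hδ0 j).le, hldef]
    calc _ = 4 * A * M * (δ j ^ s * 2 ^ j) * (r ^ s * r ^ (-s)) := by ring
      _ = 4 * A * M * (δ j ^ s * 2 ^ j) := by rw [hrs, mul_one]
      _ ≤ _ := by gcongr
  have t3 := aux_holder (s/n) hα0 hα1 θ (fun k => (hθ0 k).le) k (hθs k)
  have t4 : ∑ j ∈ Finset.range k, (r * δ j) ^ s * (4 * (l * 2 ^ j)) ≤
      4 * A * M * (4 * (k:ℝ) ^ (1 - s/n)) := by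
    refine (Finset.sum_le_sum fun j _ => t2 j).trans ?_
    rw [← Finset.mul_sum]
    gcongr
  have t5 : (k:ℝ) ^ (1 - s/n) ≤ ((k:ℝ)+1) ^ (1 - s/n) :=
    Real.rpow_le_rpow (by positivity) (by linarith) (by linarith)
  have t6 : 1 ≤ ((k:ℝ)+1) ^ (1 - s/n) :=
    Real.one_le_rpow (by linarith [(Nat.cast_nonneg k : (0:ℝ) ≤ k)]) (by linarith)
  have hAM : 0 < A * M := by positivity
  nlinarith [mul_le_mul_of_nonneg_left t5 hAM.le, mul_le_mul_of_nonneg_left t6 hAM.le,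
    mul_le_mul_of_nonneg_left t6 hM.le]

lemma aux_core {n : ℕ} (hn : 2 ≤ n) (s : ℝ) (hs : s ∈ Set.Ioc (0:ℝ) 1) (A : ℝ) (hA : 0 < A)
    (hAp : A ^ ((n:ℝ)/s) * (volume (ball (0 : Eu n) 1)).toReal = 2 ^ (n+2))
    (x₀ : Eu n) (r : ℝ) (hr : 0 < r) (u g : Eu n → ℝ) (hg : Measurable g)
    (hg0 : ∀ x, 0 ≤ g x) (N : Set (Eu n)) (hN : volume N = 0)
    (hug : ∀ x ∈ ball x₀ (4*r) \ N, ∀ y ∈ ball x₀ (4*r) \ N,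
      |u x - u y| ≤ dist x y ^ s * (g x + g y)) (M : ℝ) (hM : 0 < M)
    (hI : ∫⁻ x in ball x₀ (4*r), ENNReal.ofReal (g x ^ ((n:ℝ)/s))
      ≤ ENNReal.ofReal (M ^ ((n:ℝ)/s))) :
    ∃ c : ℝ, ∃ h : Eu n → ℝ, Measurable h ∧ (∀ x, 0 ≤ h x) ∧
      (∀ x ∈ ball x₀ r \ N,
        Real.exp ((|u x - c| / ((24 * A + 1) * M)) ^ ((n:ℝ)/((n:ℝ)-s)) / 2) ≤ 4 * h x) ∧
      ∫⁻ x in ball x₀ r, ENNReal.ofReal (h x) ≤ 2 * volume (ball x₀ r) := by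
  obtain ⟨c, hc⟩ := aux_params hn s hs A hA hAp x₀ r hr u g hg hg0 N hN hug M hM hI
  obtain ⟨hs0, hs1⟩ := hs
  have hn2 : (2:ℝ) ≤ n := by exact_mod_cast hn
  have hn0 : (0:ℝ) < n := by linarith
  set p : ℝ := (n:ℝ)/s with hp
  have hpn : (n:ℝ) ≤ p := by rw [hp, le_div_iff₀ hs0]; nlinarith
  have hp1 : 1 ≤ p := by linarith
  have hp0 : 0 < p := by linarith
  have hsp : s * p = n := by rw [hp]; field_simp
  have hωtop : volume (ball (0 : Eu n) 1) ≠ ⊤ := measure_ball_lt_top.ne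
  set ω := (volume (ball (0 : Eu n) 1)).toReal with hω
  have hω0 : 0 < ω := ENNReal.toReal_pos (measure_ball_pos _ _ one_pos).ne' hωtop
  set l := A * M * r ^ (-s) with hldef
  have hl : 0 < l := by positivity
  have hlp : l ^ p * (ω * r ^ n) = 2 ^ (n+2) * M ^ p := by
    have e1 : (r ^ (-s)) ^ p = (r ^ n)⁻¹ := by
      rw [← Real.rpow_mul hr.le, neg_mul, hsp, Real.rpow_neg hr.le, Real.rpow_natCast]
    rw [hldef, Real.mul_rpow (by positivity) (by positivity), Real.mul_rpow hA.le hM.le, e1, ← hAp]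
    field_simp
  have hlp0 : 0 < l ^ p := by positivity
  have hns : 0 < (n:ℝ) - s := by linarith
  set q : ℝ := (n:ℝ)/((n:ℝ)-s) with hq
  have hq0 : 0 < q := by positivity
  have hLM : 0 < (24 * A + 1) * M := by positivity
  have hvq : ∀ k : ℕ, ∀ x ∈ ball x₀ r \ N, g x ≤ l * 2 ^ k →
      (|u x - c| / ((24 * A + 1) * M)) ^ q ≤ (k:ℝ) + 1 := by
    intro k x hx hgx
    have h1 : |u x - c| / ((24 * A + 1) * M) ≤ ((k:ℝ)+1) ^ (1 - s / n) := by
      rw [div_le_iff₀ hLM, mul_comm]; exact hc k x hx hgx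
    calc _ ≤ (((k:ℝ)+1) ^ (1 - s / n)) ^ q := Real.rpow_le_rpow (by positivity) h1 hq0.le
      _ = _ := by
        rw [← Real.rpow_mul (by positivity)]
        have : (1 - s / n) * q = 1 := by rw [hq]; field_simp
        rw [this, Real.rpow_one]
  have hexp : Real.exp (1/2) ≤ 2 := by
    have h := Real.exp_one_lt_d9
    have e : Real.exp (1/2) * Real.exp (1/2) = Real.exp 1 := by rw [← Real.exp_add]; norm_num
    nlinarith [Real.exp_pos (1/2)]
  refine ⟨c, fun x => 1 + g x ^ p / l ^ p, by fun_prop, fun x => ?_, fun x hx => ?_, ?_⟩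
  · have := hg0 x; positivity
  · have hgp : 0 ≤ g x ^ p / l ^ p := by have := hg0 x; positivity
    have hex : ∃ k : ℕ, g x ≤ l * 2 ^ k := by
      obtain ⟨k, hk⟩ := pow_unbounded_of_one_lt (g x / l) (one_lt_two)
      exact ⟨k, by rw [div_lt_iff₀ hl] at hk; linarith⟩
    classical
    have hk := Nat.find_spec hex
    have hmin := fun j (hj : j < Nat.find hex) => Nat.find_min hex hj
    generalize Nat.find hex = k at hk hmin
    have h1 := hvq k x hx hk
    cases k with
    | zero =>
      calc _ ≤ Real.exp (1/2) := by
            apply Real.exp_le_exp.2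
            norm_num at h1 ⊢; linarith
        _ ≤ _ := by linarith
    | succ k =>
      have h2 := hmin k (Nat.lt_succ_self k)
      push Not at h2
      have h3 : (2:ℝ)^k < g x / l := by rw [lt_div_iff₀ hl]; linarith
      have h4 : 1 ≤ g x / l := (one_le_pow₀ (by norm_num : (1:ℝ) ≤ 2)).trans h3.le
      have h5 : g x / l ≤ g x ^ p / l ^ p := by
        rw [← Real.div_rpow (hg0 x) hl.le]
        calc g x / l = (g x / l) ^ (1:ℝ) := by simp
          _ ≤ _ := Real.rpow_le_rpow_of_exponent_le h4 hp1
      calc _ ≤ Real.exp ((k+2 : ℕ) * (1/2)) := by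
            apply Real.exp_le_exp.2
            push_cast at h1 ⊢; linarith
        _ = Real.exp (1/2) ^ (k+2) := by rw [Real.exp_nat_mul]
        _ ≤ 2 ^ (k+2) := by gcongr
        _ = 4 * 2 ^ k := by ring
        _ ≤ _ := by linarith
  · have e1 : ∀ x, ENNReal.ofReal (1 + g x ^ p / l ^ p)
        = 1 + ENNReal.ofReal (g x ^ p) * ENNReal.ofReal ((l ^ p)⁻¹) := by
      intro x
      have := Real.rpow_nonneg (hg0 x) p
      rw [ENNReal.ofReal_add zero_le_one (by positivity), ENNReal.ofReal_one, div_eq_mul_inv,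
        ENNReal.ofReal_mul this]
    simp only [e1]
    rw [lintegral_add_left measurable_const, lintegral_mul_const _ (by fun_prop), lintegral_one,
      Measure.restrict_apply_univ, two_mul]
    gcongr
    calc _ ≤ (∫⁻ x in ball x₀ (4*r), ENNReal.ofReal (g x ^ p)) * ENNReal.ofReal ((l ^ p)⁻¹) := by
          gcongr; linarith
      _ ≤ ENNReal.ofReal (M ^ p) * ENNReal.ofReal ((l ^ p)⁻¹) := by gcongr
      _ = ENNReal.ofReal (M ^ p * (l ^ p)⁻¹) := by rw [ENNReal.ofReal_mul (by positivity)]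
      _ ≤ ENNReal.ofReal (r ^ n * ω) := by
          apply ENNReal.ofReal_le_ofReal
          rw [← div_eq_mul_inv, div_le_iff₀ hlp0]
          have h1 : (1:ℝ) ≤ 2^(n+2) := one_le_pow₀ (by norm_num)
          have : 0 < M ^ p := by positivity
          nlinarith
      _ = _ := by
          rw [Measure.addHaar_ball_of_pos _ _ hr, ENNReal.ofReal_mul (by positivity),
            ENNReal.ofReal_toReal hωtop, finrank_euclideanSpace_fin]

lemma aux_avg_s16 {n : ℕ} (x₀ : Eu n) (r : ℝ) (hr : 0 < r) (u : Eu n → ℝ) (hu : Measurable u)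
    (c K : ℝ) (hK : 0 ≤ K)
    (h : ∫⁻ x in ball x₀ r, ENNReal.ofReal |u x - c| ≤ ENNReal.ofReal K * volume (ball x₀ r)) :
    |(⨍ y in ball x₀ r, u y) - c| ≤ K := by
  have hvt : volume (ball x₀ r) ≠ ⊤ := measure_ball_lt_top.ne
  have hv0 : 0 < volume.real (ball x₀ r) :=
    ENNReal.toReal_pos (measure_ball_pos _ _ hr).ne' hvt
  have hic : IntegrableOn (fun _ : Eu n => c) (ball x₀ r) := integrableOn_const hvt
  have hfin : ENNReal.ofReal K * volume (ball x₀ r) ≠ ⊤ := ENNReal.mul_ne_top ENNReal.ofReal_ne_top hvt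
  have hi : IntegrableOn (fun x => u x - c) (ball x₀ r) := by
    refine ⟨(hu.sub measurable_const).aestronglyMeasurable, ?_⟩
    rw [hasFiniteIntegral_iff_norm]
    simp only [Real.norm_eq_abs]
    exact lt_of_le_of_lt h hfin.lt_top
  have hiu : IntegrableOn u (ball x₀ r) := by
    have := hi.add hic
    simpa [Pi.add_def] using this
  have e : (⨍ y in ball x₀ r, u y) - c
      = (volume.real (ball x₀ r))⁻¹ * ∫ y in ball x₀ r, (u y - c) := by
    rw [setAverage_eq, integral_sub hiu hic, setIntegral_const, smul_eq_mul, smul_eq_mul]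
    field_simp
  rw [e, abs_mul, abs_of_pos (inv_pos.2 hv0), inv_mul_le_iff₀ hv0]
  have h1 : |∫ y in ball x₀ r, (u y - c)| ≤ ∫ y in ball x₀ r, |u y - c| :=
    abs_integral_le_integral_abs
  refine h1.trans ?_
  rw [integral_eq_lintegral_of_nonneg_ae (Filter.Eventually.of_forall fun x => abs_nonneg _)
    (by fun_prop)]
  refine (ENNReal.toReal_mono hfin h).trans ?_
  rw [ENNReal.toReal_mul, ENNReal.toReal_ofReal hK, mul_comm]
  rfl

theorem stmt16 {n : ℕ} (hn : 2 ≤ n) (s : ℝ) (hs : s ∈ Set.Ioc (0:ℝ) 1) :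
    ∃ C₁ C₂ : ℝ, 0 < C₁ ∧ C₁ < 1 ∧ 1 < C₂ ∧
      ∀ (x₀ : Eu n) (r : ℝ), 0 < r → ∀ u : Eu n → ℝ, Measurable u →
        fullNorm (ball x₀ (4 * r)) s ((n : ℝ) / s) u ≠ 0 →
        fullNorm (ball x₀ (4 * r)) s ((n : ℝ) / s) u < ⊤ →
        (∫⁻ x in ball x₀ r, ENNReal.ofReal (Real.exp
            ((C₁ * |u x - ⨍ y in ball x₀ r, u y| /
              (fullNorm (ball x₀ (4 * r)) s ((n : ℝ) / s) u).toReal) ^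
                ((n : ℝ) / ((n : ℝ) - s)))))
          ≤ ENNReal.ofReal C₂ * volume (ball x₀ r) := by
  have hs' := hs
  obtain ⟨hs0, hs1⟩ := hs'
  have hn2 : (2:ℝ) ≤ n := by exact_mod_cast hn
  have hn0 : (0:ℝ) < n := by linarith
  have hns : 0 < (n:ℝ) - s := by linarith
  set p : ℝ := (n:ℝ)/s with hp
  have hp0 : 0 < p := by positivity
  set q : ℝ := (n:ℝ)/((n:ℝ)-s) with hq
  have hq1 : 1 ≤ q := by rw [hq, le_div_iff₀ hns]; linarith
  have hq0 : 0 < q := by linarith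
  have hωtop : volume (ball (0 : Eu n) 1) ≠ ⊤ := measure_ball_lt_top.ne
  obtain ⟨A, hA, hAp⟩ : ∃ A : ℝ, 0 < A ∧
      A ^ p * (volume (ball (0 : Eu n) 1)).toReal = 2 ^ (n+2) := by
    have hω0 : 0 < (volume (ball (0 : Eu n) 1)).toReal :=
      ENNReal.toReal_pos (measure_ball_pos _ _ one_pos).ne' hωtop
    refine ⟨(2 ^ (n+2) / (volume (ball (0 : Eu n) 1)).toReal) ^ (1/p), by positivity, ?_⟩
    rw [← Real.rpow_mul (by positivity), one_div_mul_cancel hp0.ne', Real.rpow_one]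
    field_simp
  set L : ℝ := 24 * A + 1 with hL
  have hL1 : 1 < L := by linarith
  have hL0 : 0 < L := by linarith
  have h16 : 0 < (16:ℝ) ^ q := by positivity
  refine ⟨1 / (8 * L), Real.exp (16 ^ q / 2) * 8, by positivity, ?_, ?_, ?_⟩
  · rw [div_lt_one (by positivity)]; linarith
  · have : 1 < Real.exp (16 ^ q / 2) := Real.one_lt_exp_iff.2 (by positivity)
    linarith
  intro x₀ r hr u hu hF0 hFt
  set F := fullNorm (ball x₀ (4 * r)) s p u with hF
  have hFr : 0 < F.toReal := ENNReal.toReal_pos hF0 hFt.ne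
  have hlt : F < 2 * F := by
    rw [two_mul]; exact ENNReal.lt_add_right hFt.ne hF0
  obtain ⟨g, ⟨hgm, hg0, N, _, hN, hug⟩, hgn⟩ :
      ∃ g ∈ DFull (ball x₀ (4 * r)) s u,
        eLpNorm g (ENNReal.ofReal p) (volume.restrict (ball x₀ (4 * r))) < 2 * F := by
    have h := hlt
    nth_rewrite 1 [hF] at h
    unfold fullNorm at h
    simpa only [iInf_lt_iff, exists_prop] using h
  set M : ℝ := 2 * F.toReal with hM
  have hM0 : 0 < M := by positivity
  have hMF : ENNReal.ofReal M = 2 * F := by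
    rw [hM, ENNReal.ofReal_mul (by norm_num), ENNReal.ofReal_toReal hFt.ne]; simp
  have hI : ∫⁻ x in ball x₀ (4*r), ENNReal.ofReal (g x ^ p) ≤ ENNReal.ofReal (M ^ p) := by
    rw [← hMF, eLpNorm_eq_lintegral_rpow_enorm_toReal (by simpa using hp0) ENNReal.ofReal_ne_top,
      ENNReal.toReal_ofReal hp0.le] at hgn
    have h := ENNReal.rpow_le_rpow hgn.le hp0.le
    rw [← ENNReal.rpow_mul, one_div_mul_cancel hp0.ne', ENNReal.rpow_one,
      ENNReal.ofReal_rpow_of_nonneg hM0.le hp0.le] at h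
    refine le_trans (le_of_eq ?_) h
    congr 1
    ext x
    rw [Real.enorm_of_nonneg (hg0 x), ENNReal.ofReal_rpow_of_nonneg (hg0 x) hp0.le]
  obtain ⟨c, h, hhm, hh0, hexp, hhI⟩ :=
    aux_core hn s hs A hA hAp x₀ r hr u g hgm hg0 N hN hug M hM0 hI
  have hLM : 0 < L * M := by positivity
  have hae : ∀ᵐ x ∂(volume.restrict (ball x₀ r)), x ∈ ball x₀ r \ N := by
    have h1 : ∀ᵐ x ∂(volume.restrict (ball x₀ r)), x ∈ ball x₀ r :=
      ae_restrict_mem measurableSet_ball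
    have h2 : ∀ᵐ x ∂(volume.restrict (ball x₀ r)), x ∉ N :=
      ae_restrict_of_ae (measure_eq_zero_iff_ae_notMem.1 hN)
    filter_upwards [h1, h2] with x a b using ⟨a, b⟩
  have havg : |(⨍ y in ball x₀ r, u y) - c| ≤ 16 * (L * M) := by
    apply aux_avg_s16 x₀ r hr u hu c _ (by positivity)
    calc _ ≤ ∫⁻ x in ball x₀ r, ENNReal.ofReal (8 * (L * M)) * ENNReal.ofReal (h x) := by
          apply lintegral_mono_ae
          filter_upwards [hae] with x hx
          rw [← ENNReal.ofReal_mul (by positivity)]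
          apply ENNReal.ofReal_le_ofReal
          have h1 := hexp x hx
          set v := |u x - c| / (L * M) with hv
          have hv0 : 0 ≤ v := by positivity
          have h2 : v ≤ 1 + v ^ q := by
            rcases le_total v 1 with h | h
            · have : 0 ≤ v ^ q := by positivity
              linarith
            · have : v ^ (1:ℝ) ≤ v ^ q := Real.rpow_le_rpow_of_exponent_le h hq1
              rw [Real.rpow_one] at this
              linarith
          have h3 := Real.add_one_le_exp (v ^ q / 2)
          have h4 : v ≤ 8 * h x := by linarith
          have h5 : |u x - c| = v * (L * M) := by rw [hv]; field_simp
          rw [h5]; nlinarith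
      _ = ENNReal.ofReal (8 * (L * M)) * ∫⁻ x in ball x₀ r, ENNReal.ofReal (h x) := by
          rw [lintegral_const_mul _ (by fun_prop)]
      _ ≤ ENNReal.ofReal (8 * (L * M)) * (2 * volume (ball x₀ r)) := by gcongr
      _ = _ := by
          rw [← mul_assoc]
          congr 1
          rw [show (2:ℝ≥0∞) = ENNReal.ofReal 2 by simp, ← ENNReal.ofReal_mul (by positivity)]
          congr 1; ring
  calc _ ≤ ∫⁻ x in ball x₀ r, ENNReal.ofReal (Real.exp (16 ^ q / 2) * 4) * ENNReal.ofReal (h x) := by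
        apply lintegral_mono_ae
        filter_upwards [hae] with x hx
        rw [← ENNReal.ofReal_mul (by positivity)]
        apply ENNReal.ofReal_le_ofReal
        have h1 := hexp x hx
        set v := |u x - c| / (L * M) with hv
        have hv0 : 0 ≤ v := by positivity
        have h5 : |u x - c| = v * (L * M) := by rw [hv]; field_simp
        set b := ⨍ y in ball x₀ r, u y with hb
        have h6 : |u x - b| ≤ (v + 16) * (L * M) := by
          have := abs_sub_le (u x) c b
          rw [abs_sub_comm c b] at this
          linarith
        have h7 : 1 / (8 * L) * |u x - b| / F.toReal ≤ (v + 16) / 4 := by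
          rw [div_le_iff₀ hFr, one_div, inv_mul_le_iff₀ (by positivity)]
          refine h6.trans (le_of_eq ?_)
          rw [hM]; ring
        have h8 : (1 / (8 * L) * |u x - b| / F.toReal) ^ q ≤ v ^ q / 2 + 16 ^ q / 2 := by
          have hmax : ((v + 16) / 4) ≤ max v 16 / 2 := by
            have := le_max_left v 16
            have := le_max_right v 16
            linarith
          have hm0 : 0 ≤ max v 16 := hv0.trans (le_max_left _ _)
          have h2q : (2:ℝ) ≤ 2 ^ q := by
            calc (2:ℝ) = 2 ^ (1:ℝ) := by simp
              _ ≤ _ := Real.rpow_le_rpow_of_exponent_le (by norm_num) hq1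
          calc _ ≤ (max v 16 / 2) ^ q :=
                Real.rpow_le_rpow (by positivity) (h7.trans hmax) hq0.le
            _ = (max v 16) ^ q / 2 ^ q := Real.div_rpow hm0 (by norm_num) _
            _ ≤ (max v 16) ^ q / 2 := by gcongr
            _ ≤ _ := by
                have : 0 ≤ v ^ q := by positivity
                rcases max_choice v 16 with e | e <;> rw [e] <;> linarith
        calc _ ≤ Real.exp (v ^ q / 2 + 16 ^ q / 2) := Real.exp_le_exp.2 h8
          _ = Real.exp (16 ^ q / 2) * Real.exp (v ^ q / 2) := by rw [add_comm, Real.exp_add]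
          _ ≤ Real.exp (16 ^ q / 2) * (4 * h x) := by gcongr
          _ = _ := by ring
    _ = ENNReal.ofReal (Real.exp (16 ^ q / 2) * 4) * ∫⁻ x in ball x₀ r, ENNReal.ofReal (h x) := by
        rw [lintegral_const_mul _ (by fun_prop)]
    _ ≤ ENNReal.ofReal (Real.exp (16 ^ q / 2) * 4) * (2 * volume (ball x₀ r)) := by gcongr
    _ = _ := by
        rw [← mul_assoc]
        congr 1
        rw [show (2:ℝ≥0∞) = ENNReal.ofReal 2 by simp, ← ENNReal.ofReal_mul (by positivity)]
        congr 1; ring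
end
end
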